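/- Define F : (ℝ²)⁴ → ℝ⁴ by F(x₁,x₂,x₃,x₄) = (|x₁−x₂|, |x₂−x₃|, |x₃−x₄|, |x₄−x₁|), and let p = ((0,0), (1,0), (2,0), (1,0)) ∈ (ℝ²)⁴. Then F(p) = (1,1,1,1), F is differentiable at p, and the Fréchet derivative of F at p is not surjective (its image is a proper subspace of ℝ⁴ of dimension 3). Consequently (1,1,1,1) is not a regular value of F, i.e., the 4-cycle graph is not regularly realizable in ℝ². -/

import Mathlib

open MeasureTheory ENNReal NNReal

noncomputable section

/-- The distance map of the 4-cycle:
`F(x₁,x₂,x₃,x₄) = (|x₁−x₂|, |x₂−x₃|, |x₃−x₄|, |x₄−x₁|)` on `(ℝ²)⁴`. -/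
def cycleMap (x : Fin 4 → EuclideanSpace ℝ (Fin 2)) : Fin 4 → ℝ :=
  ![dist (x 0) (x 1), dist (x 1) (x 2), dist (x 2) (x 3), dist (x 3) (x 0)]

/-- The degenerate configuration `((0,0), (1,0), (2,0), (1,0))`. -/
def badPoint : Fin 4 → EuclideanSpace ℝ (Fin 2) :=
  ![(WithLp.equiv 2 (Fin 2 → ℝ)).symm ![0, 0],
    (WithLp.equiv 2 (Fin 2 → ℝ)).symm ![1, 0],
    (WithLp.equiv 2 (Fin 2 → ℝ)).symm ![2, 0],
    (WithLp.equiv 2 (Fin 2 → ℝ)).symm ![1, 0]]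

/-- Away from the diagonal, the distance between two differentiable maps is
differentiable, with derivative `dist⁻¹ • ⟪f x - g x, f' - g'⟫`. -/
theorem hasFDerivAt_dist_of_ne {E G : Type*} [NormedAddCommGroup E] [InnerProductSpace ℝ E]
    [NormedAddCommGroup G] [NormedSpace ℝ G] {f g : G → E} {f' g' : G →L[ℝ] E} {x : G}
    (hf : HasFDerivAt f f' x) (hg : HasFDerivAt g g' x) (hne : f x ≠ g x) :
    HasFDerivAt (fun y => dist (f y) (g y))
      ((dist (f x) (g x))⁻¹ • (innerSL ℝ (f x - g x)).comp (f' - g')) x := by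
  have hsq : ‖f x - g x‖ ^ 2 ≠ 0 := pow_ne_zero 2 (norm_ne_zero_iff.2 (sub_ne_zero.2 hne))
  have h := (hf.sub hg).norm_sq.sqrt hsq
  simp only [Pi.sub_apply, ← dist_eq_norm, Real.sqrt_sq dist_nonneg] at h
  refine h.congr_fderiv ?_
  ext v
  simp only [smul_apply, smul_eq_mul, nsmul_eq_mul, Nat.cast_ofNat]
  ring

/-- The derivative of `cycleMap` at `badPoint`. -/
def cycleMapDeriv : (Fin 4 → EuclideanSpace ℝ (Fin 2)) →L[ℝ] (Fin 4 → ℝ) :=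
  ContinuousLinearMap.pi fun k =>
    (innerSL ℝ (badPoint k - badPoint (k + 1))).comp
      (ContinuousLinearMap.proj (R := ℝ) (φ := fun _ : Fin 4 => EuclideanSpace ℝ (Fin 2)) k -
        ContinuousLinearMap.proj (k + 1))

theorem cycleMap_apply (x : Fin 4 → EuclideanSpace ℝ (Fin 2)) (k : Fin 4) :
    cycleMap x k = dist (x k) (x (k + 1)) := by
  fin_cases k <;> rfl

theorem badPoint_sub (k : Fin 4) :
    badPoint k - badPoint (k + 1) = !₂[(![-1, -1, 1, 1] : Fin 4 → ℝ) k, 0] := by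
  have hk : badPoint k = !₂[(![0, 1, 2, 1] : Fin 4 → ℝ) k, 0] := by fin_cases k <;> rfl
  have hk' : badPoint (k + 1) = !₂[(![1, 2, 1, 0] : Fin 4 → ℝ) k, 0] := by fin_cases k <;> rfl
  rw [hk, hk']
  ext i
  fin_cases k <;> fin_cases i <;> norm_num

theorem dist_badPoint (k : Fin 4) : dist (badPoint k) (badPoint (k + 1)) = 1 := by
  rw [dist_eq_norm, badPoint_sub]
  fin_cases k <;> simp [EuclideanSpace.norm_eq, Fin.sum_univ_two]

theorem hasFDerivAt_cycleMap_badPoint : HasFDerivAt cycleMap cycleMapDeriv badPoint := by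
  refine hasFDerivAt_pi'' fun k => ?_
  simp only [cycleMap_apply]
  have hne : badPoint k ≠ badPoint (k + 1) :=
    dist_ne_zero.1 (by rw [dist_badPoint]; exact one_ne_zero)
  refine (hasFDerivAt_dist_of_ne (hasFDerivAt_apply k badPoint)
    (hasFDerivAt_apply (k + 1) badPoint) hne).congr_fderiv ?_
  rw [dist_badPoint, inv_one, one_smul]
  rfl

theorem cycleMapDeriv_apply (v : Fin 4 → EuclideanSpace ℝ (Fin 2)) :
    cycleMapDeriv v = ![v 1 0 - v 0 0, v 2 0 - v 1 0, v 2 0 - v 3 0, v 3 0 - v 0 0] := by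
  ext k
  fin_cases k <;>
    simp [cycleMapDeriv, badPoint_sub, PiLp.inner_apply, Fin.sum_univ_two, neg_add_eq_sub]

/-- The linear relation `y₀ + y₁ - y₂ - y₃` cutting out the image of the derivative. -/
def cycleRelation : Module.Dual ℝ (Fin 4 → ℝ) :=
  LinearMap.proj (R := ℝ) (φ := fun _ : Fin 4 => ℝ) 0 + LinearMap.proj 1 -
    LinearMap.proj 2 - LinearMap.proj 3

theorem cycleRelation_apply (y : Fin 4 → ℝ) : cycleRelation y = y 0 + y 1 - y 2 - y 3 := rfl

theorem cycleRelation_ne_zero : cycleRelation ≠ 0 := fun h => by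
  simpa [cycleRelation_apply] using LinearMap.congr_fun h (Pi.single 0 1)

theorem range_cycleMapDeriv :
    LinearMap.range (cycleMapDeriv : (Fin 4 → EuclideanSpace ℝ (Fin 2)) →ₗ[ℝ] (Fin 4 → ℝ)) =
      LinearMap.ker cycleRelation := by
  ext y
  rw [LinearMap.mem_ker, cycleRelation_apply, LinearMap.mem_range]
  constructor
  · rintro ⟨v, rfl⟩
    simp [cycleMapDeriv_apply]
  · intro hy
    refine ⟨![0, !₂[y 0, 0], !₂[y 0 + y 1, 0], !₂[y 3, 0]], ?_⟩
    rw [ContinuousLinearMap.coe_coe, cycleMapDeriv_apply]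
    ext k
    fin_cases k <;> simp
    linarith

theorem finrank_range_cycleMapDeriv :
    Module.finrank ℝ (LinearMap.range
      (cycleMapDeriv : (Fin 4 → EuclideanSpace ℝ (Fin 2)) →ₗ[ℝ] (Fin 4 → ℝ))) = 3 := by
  have h := Module.Dual.finrank_ker_add_one_of_ne_zero cycleRelation_ne_zero
  rw [Module.finrank_fin_fun] at h
  rw [range_cycleMapDeriv]
  omega

/-- **The 4-cycle is not regularly realizable in `ℝ²`.** At the configuration
`p = ((0,0),(1,0),(2,0),(1,0))` all four edge lengths equal `1` and the distance map `F`
is differentiable, but its Fréchet derivative is not surjective: its image is a proper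
subspace of `ℝ⁴` of dimension `3`.  Hence `(1,1,1,1)` is not a regular value of `F`. -/
theorem four_cycle_not_regularly_realizable :
    cycleMap badPoint = ![1, 1, 1, 1] ∧
    DifferentiableAt ℝ cycleMap badPoint ∧
    ¬ Function.Surjective (fderiv ℝ cycleMap badPoint) ∧
    Module.finrank ℝ (LinearMap.range ((fderiv ℝ cycleMap badPoint) :
      (Fin 4 → EuclideanSpace ℝ (Fin 2)) →ₗ[ℝ] (Fin 4 → ℝ))) = 3 := by
  rw [hasFDerivAt_cycleMap_badPoint.fderiv]
  refine ⟨?_, hasFDerivAt_cycleMap_badPoint.differentiableAt, fun hsurj => ?_,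
    finrank_range_cycleMapDeriv⟩
  · ext k
    rw [cycleMap_apply, dist_badPoint]
    fin_cases k <;> rfl
  · have h := finrank_range_cycleMapDeriv
    rw [LinearMap.range_eq_top.2 hsurj, finrank_top, Module.finrank_fin_fun] at h
    omega
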